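/- Suppose HVC[n] holds for some second-order homogeneous constant-coefficient operator Δ_A with A ∈ SM(n, ℂ) of rank r < n. Then for every k ≥ r, VC[k] holds for Δ_B for every symmetric matrix B ∈ SM(k, ℂ) of rank r. -/

import Mathlib

open MvPolynomial

noncomputable def Delta {n : ℕ} (A : Matrix (Fin n) (Fin n) ℂ) :
    Module.End ℂ (MvPolynomial (Fin n) ℂ) :=
  ∑ i, ∑ j, A i j • ((pderiv i).toLinearMap ∘ₗ (pderiv j).toLinearMap)

/-- `P` is `Λ`-nilpotent: `Λ^m(P^m) = 0` for all `m ≥ 1`. -/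
def LNil {n : ℕ} (Λ : Module.End ℂ (MvPolynomial (Fin n) ℂ))
    (P : MvPolynomial (Fin n) ℂ) : Prop :=
  ∀ m : ℕ, 1 ≤ m → (Λ ^ m) (P ^ m) = 0

/-- The Vanishing Conjecture holds for `Λ`. -/
def VC {n : ℕ} (Λ : Module.End ℂ (MvPolynomial (Fin n) ℂ)) : Prop :=
  ∀ P : MvPolynomial (Fin n) ℂ, LNil Λ P →
    ∃ N : ℕ, ∀ m : ℕ, N ≤ m → (Λ ^ m) (P ^ (m + 1)) = 0

/-- The homogeneous Vanishing Conjecture holds for `Λ`. -/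
def HVC {n : ℕ} (Λ : Module.End ℂ (MvPolynomial (Fin n) ℂ)) : Prop :=
  ∀ P : MvPolynomial (Fin n) ℂ, (∃ d : ℕ, P.IsHomogeneous d) → LNil Λ P →
    ∃ N : ℕ, ∀ m : ℕ, N ≤ m → (Λ ^ m) (P ^ (m + 1)) = 0

lemma pderiv_algHom_of_pderiv_X {n k : ℕ} (L : Matrix (Fin k) (Fin n) ℂ)
    (f : MvPolynomial (Fin k) ℂ →ₐ[ℂ] MvPolynomial (Fin n) ℂ)
    (hf : ∀ i a, pderiv a (f (X i)) = C (L i a)) (a : Fin n) (P : MvPolynomial (Fin k) ℂ) :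
    pderiv a (f P) = ∑ i, L i a • f (pderiv i P) := by
  induction P using MvPolynomial.induction_on with
  | C c =>
    rw [← algebraMap_eq, f.commutes, algebraMap_eq, algebraMap_eq]
    simp
  | add p q hp hq => simp [hp, hq, Finset.sum_add_distrib]
  | mul_X p i hp =>
    simp only [map_mul, Derivation.leibniz, hp, hf, pderiv_X, map_add, smul_eq_mul, smul_add,
      Finset.sum_add_distrib, Finset.mul_sum, mul_smul_comm]
    congr 1
    rw [Finset.sum_eq_single i]
    · simp [smul_eq_C_mul, mul_comm]
    · intro j _ hj
      simp [hj.symm]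
    · simp

lemma Delta_apply {n : ℕ} (A : Matrix (Fin n) (Fin n) ℂ) (P : MvPolynomial (Fin n) ℂ) :
    Delta A P = ∑ i, ∑ j, A i j • pderiv i (pderiv j P) := by
  simp [Delta, LinearMap.sum_apply]

lemma Delta_pow_algHom {n k : ℕ} {A : Matrix (Fin n) (Fin n) ℂ} {B : Matrix (Fin k) (Fin k) ℂ}
    (L : Matrix (Fin k) (Fin n) ℂ) (c : ℂ) (hL : L * A * L.transpose = c • B)
    (f : MvPolynomial (Fin k) ℂ →ₐ[ℂ] MvPolynomial (Fin n) ℂ)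
    (hf : ∀ i a, pderiv a (f (X i)) = C (L i a)) (m : ℕ) (P : MvPolynomial (Fin k) ℂ) :
    (Delta A ^ m) (f P) = c ^ m • f ((Delta B ^ m) P) := by
  have key : ∀ P, Delta A (f P) = c • f (Delta B P) := by
    intro P
    have hB : ∀ i j, ∑ b, ∑ a, L i a * A a b * L j b = c * B i j := by
      intro i j
      have := congrFun (congrFun hL i) j
      simpa [Matrix.mul_apply, Finset.sum_mul] using this
    simp only [Delta_apply, pderiv_algHom_of_pderiv_X L f hf, map_sum, Derivation.map_smul,
      map_smul, Finset.smul_sum, smul_smul, ← hB, Finset.sum_smul]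
    simp only [← Finset.sum_product']
    refine Finset.sum_nbij' (fun x => (x.2.2.2, x.2.2.1, x.2.1, x.1))
      (fun x => (x.2.2.2, x.2.2.1, x.2.1, x.1)) ?_ ?_ ?_ ?_ ?_ <;> simp
    intro a b i j
    congr 1
    ring
  induction m generalizing P with
  | zero => simp
  | succ m ih => simp [pow_succ, key, ih, smul_smul, mul_comm]

lemma exists_diagonalization {n : ℕ} (A : Matrix (Fin n) (Fin n) ℂ) (hA : A.IsSymm) :
    ∃ (U : Matrix (Fin n) (Fin n) ℂ) (d : Fin n → ℂ), IsUnit U.det ∧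
      U * A * U.transpose = Matrix.diagonal d := by
  have hs : LinearMap.IsSymm (Matrix.toBilin' A) := by
    constructor
    intro x y
    simp only [Matrix.toBilin'_apply', RingHom.id_apply]
    rw [Matrix.dotProduct_mulVec, ← Matrix.mulVec_transpose, hA.eq, dotProduct_comm]
  have : Invertible (2 : ℂ) := invertibleOfNonzero two_ne_zero
  obtain ⟨v', hv'⟩ := LinearMap.BilinForm.exists_orthogonal_basis hs
  let e : Fin (Module.finrank ℂ (Fin n → ℂ)) ≃ Fin n := finCongr (by simp)
  let v := v'.reindex e
  have hv : ∀ i j, i ≠ j → v i ⬝ᵥ A.mulVec (v j) = 0 := by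
    intro i j hij
    have := hv' (i := e.symm i) (j := e.symm j) (by simpa using hij)
    simpa [v, Function.onFun, Matrix.toBilin'_apply'] using this
  refine ⟨Matrix.of (fun i => v i), fun i => v i ⬝ᵥ A.mulVec (v i), ?_, ?_⟩
  · rw [← Matrix.isUnit_iff_isUnit_det, ← Matrix.linearIndependent_rows_iff_isUnit]
    exact v.linearIndependent
  · ext i j
    have : (Matrix.of (fun i => v i) * A * (Matrix.of fun i => v i).transpose) i j
        = v i ⬝ᵥ A.mulVec (v j) := by
      rw [Matrix.mul_assoc]
      rfl
    rw [this, Matrix.diagonal_apply]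
    split_ifs with h
    · rw [h]
    · exact hv i j h

lemma exists_congruence_of_rank_eq {n k : ℕ} (A : Matrix (Fin n) (Fin n) ℂ)
    (B : Matrix (Fin k) (Fin k) ℂ) (hA : A.IsSymm) (hB : B.IsSymm) (h : A.rank = B.rank) :
    ∃ L : Matrix (Fin k) (Fin n) ℂ, L * A * L.transpose = B := by
  obtain ⟨U, d, hU, hd⟩ := exists_diagonalization A hA
  obtain ⟨V, e, hV, he⟩ := exists_diagonalization B hB
  have hUt : IsUnit U.transpose.det := by rwa [Matrix.det_transpose]
  have hVt : IsUnit V.transpose.det := by rwa [Matrix.det_transpose]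
  have hcard : Fintype.card {i // e i ≠ 0} = Fintype.card {i // d i ≠ 0} := by
    rw [← Matrix.rank_diagonal, ← Matrix.rank_diagonal, ← hd, ← he,
      Matrix.rank_mul_eq_left_of_isUnit_det _ _ hUt, Matrix.rank_mul_eq_right_of_isUnit_det _ _ hU,
      Matrix.rank_mul_eq_left_of_isUnit_det _ _ hVt, Matrix.rank_mul_eq_right_of_isUnit_det _ _ hV,
      h]
  let σ := Fintype.equivOfCardEq hcard
  choose s hs using fun z : ℂ => IsAlgClosed.exists_pow_nat_eq z two_pos
  let K : Matrix (Fin k) (Fin n) ℂ := Matrix.of fun i a =>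
    if hi : e i ≠ 0 then (if (σ ⟨i, hi⟩ : Fin n) = a then s (e i / d a) else 0) else 0
  have hK : K * Matrix.diagonal d * K.transpose = Matrix.diagonal e := by
    ext i j
    rw [Matrix.mul_apply]
    simp only [Matrix.mul_diagonal, Matrix.transpose_apply, Matrix.diagonal_apply, K,
      Matrix.of_apply]
    by_cases hi : e i ≠ 0
    · have hdi := (σ ⟨i, hi⟩).2
      by_cases hj : e j ≠ 0
      · simp only [hi, hj, ne_eq, not_false_eq_true, dif_pos, ite_mul, zero_mul,
          Finset.sum_ite_eq, Finset.mem_univ, if_true]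
        by_cases hij : i = j
        · subst hij
          simp only [if_true]
          rw [mul_right_comm, ← pow_two, hs, div_mul_cancel₀ _ hdi]
        · have : (σ ⟨j, hj⟩ : Fin n) ≠ σ ⟨i, hi⟩ := by
            intro hh
            have := σ.injective (Subtype.ext hh)
            simp only [Subtype.mk.injEq] at this
            exact hij this.symm
          simp [hij, this]
      · have : i ≠ j := by rintro rfl; exact hj hi
        simp [hj, this]
    · push Not at hi
      simp [hi]
  refine ⟨V⁻¹ * K * U, ?_⟩
  have : V⁻¹ * K * U * A * (V⁻¹ * K * U).transpose
      = V⁻¹ * (K * (U * A * U.transpose) * K.transpose) * (V⁻¹).transpose := by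
    simp only [Matrix.transpose_mul, Matrix.mul_assoc]
  rw [this, hd, hK, ← he, Matrix.transpose_nonsing_inv, Matrix.mul_assoc V B,
    Matrix.nonsing_inv_mul_cancel_left _ _ hV, Matrix.mul_nonsing_inv_cancel_right _ _ hVt]

lemma exists_eval_ne_zero_of_countable {k : ℕ} (Q : ℕ → MvPolynomial (Fin k) ℂ) :
    ∃ c : Fin k → ℂ, ∀ m, Q m ≠ 0 → eval c (Q m) ≠ 0 := by
  let f : ℕ → Set (Fin k → ℂ) := fun m => {c | Q m ≠ 0 → eval c (Q m) ≠ 0}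
  have ho : ∀ m, IsOpen (f m) := by
    intro m
    by_cases hm : Q m = 0
    · simp [f, hm]
    · simpa [f, hm] using isOpen_ne_fun (MvPolynomial.continuous_eval (Q m)) continuous_const
  have hd : ∀ m, Dense (f m) := by
    intro m
    rw [Metric.dense_iff]
    intro x ε hε
    by_contra hne
    rw [Set.not_nonempty_iff_eq_empty, Set.eq_empty_iff_forall_notMem] at hne
    have hm : Q m ≠ 0 := by
      intro hm
      exact hne x ⟨Metric.mem_ball_self hε, fun h => absurd hm h⟩
    apply hm
    refine MvPolynomial.funext_set (fun i => Metric.ball (x i) ε) (fun i => ?_) fun c hc => ?_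
    · exact infinite_of_mem_nhds (x i) (Metric.ball_mem_nhds _ hε)
    · rw [map_zero]
      by_contra hc'
      refine hne c ⟨?_, fun _ => hc'⟩
      rw [ball_pi _ hε]
      exact hc
  obtain ⟨c, hc⟩ := (dense_iInter_of_isOpen ho hd).nonempty
  exact ⟨c, fun m => Set.mem_iInter.1 hc m⟩

/-- The pullback of polynomials along the affine map `w ↦ L w + c`. -/
noncomputable def affinePullback {n k : ℕ} (L : Matrix (Fin k) (Fin n) ℂ) (c : Fin k → ℂ) :
    MvPolynomial (Fin k) ℂ →ₐ[ℂ] MvPolynomial (Fin n) ℂ :=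
  aeval fun i => ∑ a, C (L i a) * X a + C (c i)

lemma affinePullback_X {n k : ℕ} (L : Matrix (Fin k) (Fin n) ℂ) (c : Fin k → ℂ) (i : Fin k) :
    affinePullback L c (X i) = ∑ a, C (L i a) * X a + C (c i) := by
  simp [affinePullback]

lemma pderiv_affinePullback_X {n k : ℕ} (L : Matrix (Fin k) (Fin n) ℂ) (c : Fin k → ℂ)
    (i : Fin k) (a : Fin n) : pderiv a (affinePullback L c (X i)) = C (L i a) := by
  simp [affinePullback_X, pderiv_X, Pi.single_apply]

lemma eval_affinePullback {n k : ℕ} (L : Matrix (Fin k) (Fin n) ℂ) (c : Fin k → ℂ)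
    (w : Fin n → ℂ) (P : MvPolynomial (Fin k) ℂ) :
    eval w (affinePullback L c P) = eval (L.mulVec w + c) P := by
  induction P using MvPolynomial.induction_on with
  | C a => simp [affinePullback]
  | add p q hp hq => simp [hp, hq]
  | mul_X p i hp => simp [hp, affinePullback_X, Matrix.mulVec, dotProduct]

lemma affinePullback_affinePullback {n k l : ℕ} (L : Matrix (Fin k) (Fin n) ℂ) (c : Fin k → ℂ)
    (M : Matrix (Fin n) (Fin l) ℂ) (d : Fin n → ℂ) (P : MvPolynomial (Fin k) ℂ) :
    affinePullback M d (affinePullback L c P) =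
      affinePullback (L * M) (L.mulVec d + c) P := by
  apply MvPolynomial.funext
  intro w
  simp [eval_affinePullback, Matrix.mulVec_add, add_assoc]

lemma eval_smul_of_isHomogeneous {k j : ℕ} {P : MvPolynomial (Fin k) ℂ} (hP : P.IsHomogeneous j)
    (s : ℂ) (x : Fin k → ℂ) : eval (s • x) P = s ^ j * eval x P := by
  rw [eval_eq', eval_eq', Finset.mul_sum]
  refine Finset.sum_congr rfl fun d hd => ?_
  rw [hP.degree_eq_sum_deg_support hd, Finset.sum_subset (Finset.subset_univ _)
    fun i _ hi => Finsupp.notMem_support_iff.1 hi]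
  simp only [Pi.smul_apply, smul_eq_mul, mul_pow, Finset.prod_mul_distrib,
    Finset.prod_pow_eq_pow_sum]
  ring

/-- A homogeneous polynomial scales by `s ^ j` when its argument is scaled by `s`. -/
lemma affinePullback_smul_of_isHomogeneous {n k j : ℕ} (L : Matrix (Fin k) (Fin n) ℂ)
    (c : Fin k → ℂ) (s : ℂ) {P : MvPolynomial (Fin k) ℂ} (hP : P.IsHomogeneous j) :
    affinePullback (s • L) (s • c) P = s ^ j • affinePullback L c P := by
  apply MvPolynomial.funext
  intro w
  rw [smul_eval, eval_affinePullback, eval_affinePullback, Matrix.smul_mulVec, ← smul_add]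
  exact eval_smul_of_isHomogeneous hP _ _

/-- The homogenization of degree `P.totalDegree` of the pullback of `P` along a linear map,
with the linear form `t` as homogenizing variable. -/
noncomputable def homogenizedPullback {n k : ℕ} (L : Matrix (Fin k) (Fin n) ℂ)
    (t : MvPolynomial (Fin n) ℂ) (P : MvPolynomial (Fin k) ℂ) : MvPolynomial (Fin n) ℂ :=
  ∑ j ∈ Finset.range (P.totalDegree + 1),
    t ^ (P.totalDegree - j) * affinePullback L 0 (homogeneousComponent j P)

lemma isHomogeneous_homogenizedPullback {n k : ℕ} (L : Matrix (Fin k) (Fin n) ℂ)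
    {t : MvPolynomial (Fin n) ℂ} (ht : t.IsHomogeneous 1) (P : MvPolynomial (Fin k) ℂ) :
    (homogenizedPullback L t P).IsHomogeneous P.totalDegree := by
  apply IsHomogeneous.sum
  intro j hj
  rw [Finset.mem_range] at hj
  have h1 := ht.pow (P.totalDegree - j)
  have h2 : (affinePullback L 0 (homogeneousComponent j P)).IsHomogeneous (1 * j) := by
    refine (homogeneousComponent_isHomogeneous j P).aeval _ fun i => ?_
    simp only [Pi.zero_apply, C_0, add_zero]
    exact IsHomogeneous.sum _ _ _ fun a _ => isHomogeneous_C_mul_X _ _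
  convert h1.mul h2 using 1
  omega

/-- Restricting the homogenization to a hyperplane `t = τ` gives an affine pullback of `P`. -/
lemma affinePullback_homogenizedPullback {n k : ℕ} (L : Matrix (Fin k) (Fin n) ℂ)
    (M : Matrix (Fin n) (Fin n) ℂ) (w : Fin n → ℂ) {τ : ℂ} (hτ : τ ≠ 0)
    {t : MvPolynomial (Fin n) ℂ} (ht : affinePullback M (τ • w) t = C τ)
    (P : MvPolynomial (Fin k) ℂ) :
    affinePullback M (τ • w) (homogenizedPullback L t P) =
      τ ^ P.totalDegree • affinePullback (τ⁻¹ • (L * M)) (L.mulVec w) P := by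
  have hLM : L * M = τ • τ⁻¹ • (L * M) := by rw [smul_smul, mul_inv_cancel₀ hτ, one_smul]
  conv_rhs => rw [← sum_homogeneousComponent P, map_sum, Finset.smul_sum]
  rw [homogenizedPullback, map_sum]
  refine Finset.sum_congr rfl fun j hj => ?_
  rw [Finset.mem_range] at hj
  rw [map_mul, map_pow, ht, affinePullback_affinePullback, add_zero, Matrix.mulVec_smul, hLM,
    affinePullback_smul_of_isHomogeneous _ _ _ (homogeneousComponent_isHomogeneous j P),
    ← C_pow, ← smul_eq_C_mul, smul_smul, ← pow_add, ← hLM, sum_homogeneousComponent,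
    Nat.sub_add_cancel (Nat.lt_succ_iff.1 hj)]

/-- If `HVC[n]` holds for `Δ_A` with `A` symmetric of rank `r < n`, then for every
`k ≥ r`, `VC[k]` holds for `Δ_B` for every symmetric `B ∈ SM(k, ℂ)` of rank `r`. -/
theorem stmt5 {n r : ℕ} (A : Matrix (Fin n) (Fin n) ℂ) (hA : A.IsSymm)
    (hArank : A.rank = r) (hrn : r < n) (h : HVC (Delta A)) :
    ∀ k : ℕ, r ≤ k → ∀ B : Matrix (Fin k) (Fin k) ℂ, B.IsSymm → B.rank = r →
      VC (Delta B) := by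
  intro k _ B hB hBrank P hP
  obtain ⟨L₀, hL₀⟩ := exists_congruence_of_rank_eq A B hA hB (hArank.trans hBrank.symm)
  obtain ⟨v, hv0, hv⟩ : ∃ v, v ≠ 0 ∧ A.mulVec v = 0 := by
    rw [Matrix.exists_mulVec_eq_zero_iff]
    by_contra hdet
    have := Matrix.rank_of_isUnit A ((Matrix.isUnit_iff_isUnit_det A).2 (isUnit_iff_ne_zero.2 hdet))
    simp at this
    omega
  have hv' : Matrix.vecMul v A = 0 := by rw [← Matrix.mulVec_transpose, hA.eq, hv]
  obtain ⟨w, hw⟩ : ∃ w : Fin n → ℂ, v ⬝ᵥ w = 1 := by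
    obtain ⟨i, hi⟩ := Function.ne_iff.1 hv0
    exact ⟨Pi.single i (v i)⁻¹, by simp [mul_inv_cancel₀ hi]⟩
  obtain ⟨c, hc⟩ := exists_eval_ne_zero_of_countable fun m => (Delta B ^ m) (P ^ (m + 1))
  -- translations along the radical of `A` preserve the congruence
  have radical : ∀ {l : ℕ} (N : Matrix (Fin l) (Fin n) ℂ) (x : Fin l → ℂ),
      (N + Matrix.vecMulVec x v) * A * (N + Matrix.vecMulVec x v).transpose =
        N * A * N.transpose := by
    intro l N x
    have h1 : Matrix.vecMulVec x v * A = 0 := by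
      rw [Matrix.vecMulVec_mul, hv']
      ext
      simp [Matrix.vecMulVec_apply]
    have h2 : A * (Matrix.vecMulVec x v).transpose = 0 := by
      rw [Matrix.transpose_vecMulVec, Matrix.mul_vecMulVec, hv]
      ext
      simp [Matrix.vecMulVec_apply]
    rw [Matrix.add_mul, h1, add_zero, Matrix.transpose_add, Matrix.mul_add, Matrix.mul_assoc N A
      (Matrix.vecMulVec x v).transpose, h2, Matrix.mul_zero, add_zero]
  let L := L₀ + Matrix.vecMulVec (c - L₀.mulVec w) v
  have hL : L * A * L.transpose = B := (radical _ _).trans hL₀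
  have hLw : L.mulVec w = c := by
    simp [L, Matrix.add_mulVec, Matrix.vecMulVec_mulVec, hw]
  let M : Matrix (Fin n) (Fin n) ℂ := 1 + Matrix.vecMulVec (-w) v
  have hM : M * A * M.transpose = A := by
    rw [radical, Matrix.one_mul, Matrix.transpose_one, Matrix.mul_one]
  have hMw : ∀ x, M.mulVec x = x - (v ⬝ᵥ x) • w := by
    intro x
    simp [M, Matrix.add_mulVec, Matrix.vecMulVec_mulVec, Matrix.neg_mulVec, sub_eq_add_neg]
  let t : MvPolynomial (Fin n) ℂ := ∑ a, C (v a) * X a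
  have ht : t.IsHomogeneous 1 := IsHomogeneous.sum _ _ _ fun a _ => isHomogeneous_C_mul_X _ _
  have evalt : ∀ x, eval x t = v ⬝ᵥ x := by intro x; simp [t, dotProduct]
  have hMt : ∀ τ : ℂ, affinePullback M (τ • w) t = C τ := by
    intro τ
    apply MvPolynomial.funext
    intro x
    simp [eval_affinePullback, evalt, hMw, dotProduct_add, dotProduct_sub, hw]
  let H := homogenizedPullback L t P
  have hH : ∀ τ : ℂ, τ ≠ 0 → affinePullback M (τ • w) H =
      τ ^ P.totalDegree • affinePullback (τ⁻¹ • (L * M)) c P := by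
    intro τ hτ
    rw [affinePullback_homogenizedPullback L M w hτ (hMt τ) P, hLw]
  have key : ∀ τ : ℂ, τ ≠ 0 → ∀ m l : ℕ,
      affinePullback M (τ • w) ((Delta A ^ m) (H ^ l)) = ((τ ^ P.totalDegree) ^ l *
        (τ⁻¹ * τ⁻¹) ^ m) • affinePullback (τ⁻¹ • (L * M)) c ((Delta B ^ m) (P ^ l)) := by
    intro τ hτ m l
    have h1 := Delta_pow_algHom (A := A) (B := A) M 1 (by rw [hM, one_smul])
      (affinePullback M (τ • w)) (pderiv_affinePullback_X _ _) m (H ^ l)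
    rw [one_pow, one_smul] at h1
    have hLM : (τ⁻¹ • (L * M)) * A * (τ⁻¹ • (L * M)).transpose = (τ⁻¹ * τ⁻¹) • B := by
      have : L * M * A * (L * M).transpose = B := by
        rw [Matrix.transpose_mul, ← hL]
        conv_rhs => rw [← hM]
        simp only [Matrix.mul_assoc]
      rw [Matrix.transpose_smul, Matrix.smul_mul, Matrix.smul_mul, Matrix.mul_smul, this, smul_smul]
    rw [← h1, map_pow, hH τ hτ, smul_pow, ← map_pow, map_smul,
      Delta_pow_algHom _ _ hLM _ (pderiv_affinePullback_X _ _), smul_smul]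
  have hnil : LNil (Delta A) H := by
    intro m hm
    have hzero : t * (Delta A ^ m) (H ^ m) = 0 := by
      apply MvPolynomial.funext
      intro x
      rw [map_mul, map_zero, mul_eq_zero, evalt]
      by_cases hx : v ⬝ᵥ x = 0
      · exact Or.inl hx
      · right
        have := congrArg (eval x) (key _ hx m m)
        rw [hP m hm, map_zero, smul_zero, map_zero, eval_affinePullback, hMw,
          sub_add_cancel] at this
        exact this
    refine (mul_eq_zero.1 hzero).resolve_left fun h0 => ?_
    have := evalt w
    rw [h0, hw, map_zero] at this
    exact zero_ne_one this
  obtain ⟨N, hN⟩ := h H ⟨_, isHomogeneous_homogenizedPullback L ht P⟩ hnil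
  refine ⟨N, fun m hm => ?_⟩
  by_contra hne
  apply hc m hne
  have := congrArg (eval w) (key 1 one_ne_zero m (m + 1))
  rw [hN m hm] at this
  simpa [eval_affinePullback, ← Matrix.mulVec_mulVec, hMw, hw] using this.symm
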